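/- Let p be a prime and let C_1, C_2 be disjoint subsets of Z_p. Then ||RN_p(C_1,C_2)| − p·2^{−(|C_1|+|C_2|)}| ≤ 0.5·(|C_1|+|C_2|)·(√p + 1). -/

import Mathlib

open Finset

/-- The set of quadratic residues modulo `M`, as a finset of `ZMod M`. -/
def QR (M : ℕ) : Finset (ZMod M) := (Finset.range M).image (fun a : ℕ => ((a : ZMod M)) ^ 2)

/-- The "universe" finset of `ZMod M` (all residues), valid for any `M ≥ 1`. -/
def univM (M : ℕ) : Finset (ZMod M) := (Finset.range M).image (fun a : ℕ => (a : ZMod M))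

/-- `RN_M(C₁, C₂)` for `C₁, C₂ ⊆ Z_M`: the set of `x ∈ Z_M` with `x + c₁ ∈ R_M` for all
`c₁ ∈ C₁` and `x + c₂ ∉ R_M` for all `c₂ ∈ C₂`. -/
def RNsetZ (M : ℕ) (C₁ C₂ : Finset (ZMod M)) : Finset (ZMod M) :=
  (univM M).filter (fun x => (∀ c ∈ C₁, x + c ∈ QR M) ∧ (∀ c ∈ C₂, x + c ∉ QR M))

/-- `RN_M(C₁, C₂)` for sets `C₁, C₂` of non-negative integers, identified with their
residues in `Z_M`. -/
def RNset (M : ℕ) (C₁ C₂ : Finset ℕ) : Finset (ZMod M) :=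
  (univM M).filter
    (fun x => (∀ c ∈ C₁, x + (c : ZMod M) ∈ QR M) ∧ (∀ c ∈ C₂, x + (c : ZMod M) ∉ QR M))

/-- `N_M(C)` for a set `C` of non-negative integers (identified with residues in `Z_M`):
the set of `x ∈ Z_M` with `x + c ∉ R_M` for all `c ∈ C`. -/
def Nset (M : ℕ) (C : Finset ℕ) : Finset (ZMod M) :=
  (univM M).filter (fun x => ∀ c ∈ C, x + (c : ZMod M) ∉ QR M)

section
open Polynomial

theorem eq_zero_of_X_sub_one_pow_dvd {p : ℕ} [Fact p.Prime] {P Q : (ZMod p)[X]} {α β n : ℕ}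
    (hP : P.natDegree ≤ β) (hQ : Q.natDegree ≤ α) (hα : 0 < α) (hαn : α ≤ n) (hn : n + β < p)
    (hQ0 : Q.eval 0 = 0) (h : (X - 1) ^ (α + β + 1) ∣ P * X ^ (n + 1) - Q) : P = 0 := by
  obtain ⟨R, rfl⟩ : X ∣ Q := by rwa [X_dvd_iff, coeff_zero_eq_eval_zero]
  have hcop : IsCoprime ((X : (ZMod p)[X]) - 1) X := ⟨-1, 1, by ring⟩
  have h1 : (X - 1) ^ (α + β + 1) ∣ P * X ^ n - R := by
    refine (hcop.pow_left (m := α + β + 1)).dvd_of_dvd_mul_left ?_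
    convert h using 1; ring
  have hR : R.natDegree < α := by
    rcases eq_or_ne R 0 with rfl | hR
    · simpa using hα
    · rw [natDegree_X_mul hR] at hQ; omega
  set D := derivative^[α] (P * X ^ n) with hD
  have h2 : (X - 1) ^ (β + 1) ∣ D := by
    have := pow_sub_dvd_iterate_derivative_of_pow_dvd α h1
    rw [iterate_derivative_sub, iterate_derivative_eq_zero hR, sub_zero] at this
    convert this using 2; omega
  have h3 : X ^ (n - α) ∣ D :=
    pow_sub_dvd_iterate_derivative_of_pow_dvd α (Dvd.intro_left _ rfl)
  have h4 : (X - 1) ^ (β + 1) * X ^ (n - α) ∣ D := hcop.pow.mul_dvd h2 h3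
  have hdeg : D.natDegree ≤ β + n - α :=
    (natDegree_iterate_derivative _ _).trans
      (Nat.sub_le_sub_right (natDegree_mul_le.trans (by simpa using hP)) _)
  have hmon : ((X : (ZMod p)[X]) - 1).Monic := monic_X_sub_C 1
  have hD0 : D = 0 := by
    refine eq_zero_of_dvd_of_natDegree_lt h4 ?_
    rw [(hmon.pow _).natDegree_mul (monic_X_pow _), hmon.natDegree_pow, natDegree_X_pow,
      show (X - 1 : (ZMod p)[X]).natDegree = 1 from natDegree_X_sub_C 1]
    omega
  ext j
  by_cases hj : β < j
  · rw [coeff_eq_zero_of_natDegree_lt (hP.trans_lt hj), coeff_zero]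
  have := congrArg (coeff · (n + j - α)) hD0
  simp only [hD, coeff_iterate_derivative, coeff_zero, nsmul_eq_mul] at this
  rw [show n + j - α + α = j + n by omega, coeff_mul_X_pow] at this
  refine (mul_eq_zero.1 this).resolve_left fun h0 => ?_
  rw [ZMod.natCast_eq_zero_iff] at h0
  have h5 : p ∣ (j + n).factorial := by
    rw [← Nat.factorial_mul_descFactorial (show α ≤ j + n by omega)]
    exact h0.mul_left _
  have := (Fact.out (p := p.Prime)).dvd_factorial.1 h5
  omega

theorem eq_zero_of_X_pow_dvd {p : ℕ} [Fact p.Prime] {P Q : (ZMod p)[X]} {α β n : ℕ} {u : ZMod p}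
    (hu : u ≠ 0) (hP : P.natDegree ≤ β) (hQ : Q.natDegree ≤ α) (hα : 0 < α) (hαn : α ≤ n)
    (hn : n + β < p) (hQ0 : Q.eval (-u⁻¹) = 0)
    (h : X ^ (α + β + 1) ∣ P * (1 + X * C u) ^ (n + 1) - Q) : P = 0 := by
  set l : (ZMod p)[X] := C u⁻¹ * (X - 1) with hl
  have hl1 : l.natDegree ≤ 1 := by
    rw [hl]
    exact (natDegree_C_mul_le _ _).trans (natDegree_X_sub_C_le 1)
  have hlu : l * C u = X - 1 := by
    rw [hl, mul_right_comm, ← C_mul, inv_mul_cancel₀ hu, C_1, one_mul]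
  have hcomp (R : (ZMod p)[X]) : (R.comp l).natDegree ≤ R.natDegree :=
    natDegree_comp_le.trans (by nlinarith)
  have h0 : P.comp l = 0 := by
    refine eq_zero_of_X_sub_one_pow_dvd (Q := Q.comp l) (n := n) ((hcomp P).trans hP)
      ((hcomp Q).trans hQ) hα hαn hn ?_ ?_
    · simpa [eval_comp, hl] using hQ0
    · obtain ⟨R, hR⟩ := h
      have := congrArg (comp · l) hR
      simp only [sub_comp, mul_comp, pow_comp, add_comp, one_comp, X_comp, C_comp, hlu,
        add_sub_cancel] at this
      rw [this, ← hlu, mul_pow]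
      have hc : IsUnit (C u ^ (α + β + 1)) := (isUnit_C.2 hu.isUnit).pow _
      exact ((IsUnit.mul_right_dvd hc).2 dvd_rfl).mul_right _
  have := congrArg (comp · (1 + X * C u)) h0
  have hl' : l.comp (1 + X * C u) = X := by
    simp only [hl, mul_comp, sub_comp, C_comp, X_comp, one_comp, add_sub_cancel_left]
    rw [mul_left_comm, ← C_mul, inv_mul_cancel₀ hu, C_1, mul_one]
  simpa only [comp_assoc, hl', comp_X, zero_comp] using this

theorem natDegree_coeff_mul_le {R : Type*} [CommRing R] {A B : R[X][X]} {a b e : ℕ}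
    (hA : ∀ n, (A.coeff n).natDegree ≤ a + n * e) (hB : ∀ n, (B.coeff n).natDegree ≤ b + n * e)
    (n : ℕ) : ((A * B).coeff n).natDegree ≤ a + b + n * e := by
  rw [coeff_mul]
  refine natDegree_sum_le_of_forall_le _ _ fun x hx => natDegree_mul_le.trans ?_
  rw [HasAntidiagonal.mem_antidiagonal] at hx
  have := hA x.1
  have := hB x.2
  rw [← hx, add_mul]
  omega

theorem natDegree_coeff_prod_le {R ι : Type*} [CommRing R] {s : Finset ι} {A : ι → R[X][X]}
    {e : ℕ} (hA : ∀ i ∈ s, ∀ n, ((A i).coeff n).natDegree ≤ n * e) (n : ℕ) :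
    ((∏ i ∈ s, A i).coeff n).natDegree ≤ n * e := by
  classical
  induction s using Finset.induction_on generalizing n with
  | empty => rw [prod_empty, coeff_one]; split_ifs <;> simp
  | insert i s hi ih =>
    rw [prod_insert hi]
    simpa using natDegree_coeff_mul_le (a := 0) (b := 0)
      (by simpa using hA i (mem_insert_self _ _))
      (by simpa using ih fun j hj => hA j (mem_insert_of_mem hj)) n

theorem exists_coeff_mul_eq_zero {K : Type*} [Field K] {A : K[X][X]} {e : ℕ} (α β : ℕ)
    (hA : ∀ n, (A.coeff n).natDegree ≤ n * e) :
    ∃ P : K[X][X], P ≠ 0 ∧ P.natDegree ≤ β ∧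
      (∀ n, (P.coeff n).natDegree ≤ e * α * β + n * e) ∧
      ∀ k, α < k → k ≤ α + β → (P * A).coeff k = 0 := by
  set M := e * α * β with hM
  let I := Σ j : Fin (β + 1), Fin (M + j * e + 1)
  let J := Σ k : Fin β, Fin (M + (α + 1 + k) * e + 1)
  let L : (I → K) →ₗ[K] K[X][X] :=
    Fintype.linearCombination K fun x : I => monomial (x.1 : ℕ) (monomial (x.2 : ℕ) (1 : K))
  have hL (v : I → K) : L v = ∑ x : I, monomial (x.1 : ℕ) (monomial (x.2 : ℕ) (v x)) := by
    simp [L, Fintype.linearCombination_apply, smul_monomial]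
  have hLd (v : I → K) : (L v).natDegree ≤ β := by
    rw [hL]
    exact natDegree_sum_le_of_forall_le _ _ fun x _ =>
      (natDegree_monomial_le _).trans (Nat.le_of_lt_succ x.1.2)
  have hLc (v : I → K) (n : ℕ) : ((L v).coeff n).natDegree ≤ M + n * e := by
    rw [hL, finsetSum_coeff]
    refine natDegree_sum_le_of_forall_le _ _ fun x _ => ?_
    rw [coeff_monomial]
    split_ifs with h
    · rw [← h]
      exact (natDegree_monomial_le _).trans (Nat.le_of_lt_succ x.2.2)
    · simp
  have hLv (v : I → K) (x : I) : ((L v).coeff x.1).coeff x.2 = v x := by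
    rw [hL, finsetSum_coeff, finsetSum_coeff, sum_eq_single x]
    · simp
    · rintro ⟨y1, y2⟩ - hy
      obtain ⟨x1, x2⟩ := x
      rw [coeff_monomial]
      split_ifs with h
      · obtain rfl : y1 = x1 := Fin.ext h
        rw [coeff_monomial, if_neg]
        exact fun h' => hy (congrArg _ (Fin.ext h'))
      · simp
    · simp
  let F : (I → K) →ₗ[K] (J → K) :=
    { toFun := fun v y => ((L v * A).coeff (α + 1 + y.1)).coeff y.2
      map_add' := fun v w => by ext; simp [add_mul]
      map_smul' := fun a v => by ext; simp }
  have hcard : Module.finrank K (J → K) < Module.finrank K (I → K) := by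
    simp only [Module.finrank_fintype_fun_eq_card, I, J, Fintype.card_sigma, Fintype.card_fin]
    rw [Fin.sum_univ_succ]
    have : ∑ i : Fin β, (M + (α + 1 + i) * e + 1)
        = M + ∑ i : Fin β, (M + (i.succ : ℕ) * e + 1) := by
      have h1 (i : Fin β) : M + (α + 1 + i) * e + 1 = α * e + (M + (i.succ : ℕ) * e + 1) := by
        rw [Fin.val_succ]; ring
      rw [sum_congr rfl fun i _ => h1 i, sum_add_distrib, sum_const, card_univ,
        Fintype.card_fin, smul_eq_mul, hM]
      ring
    rw [this]
    simp
  obtain ⟨v, hv, hv0⟩ := (Submodule.ne_bot_iff _).1 (F.ker_ne_bot_of_finrank_lt hcard)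
  refine ⟨L v, fun h => hv0 ?_, hLd v, hLc v, fun k hk hk' => ?_⟩
  · ext x
    rw [← hLv v x, h]
    simp
  · ext i
    by_cases hi : i < M + k * e + 1
    · have h1 := congrFun (LinearMap.mem_ker.1 hv)
        ⟨⟨k - (α + 1), by omega⟩, ⟨i, by
          simpa only [show α + 1 + (k - (α + 1)) = k by omega] using hi⟩⟩
      simp only [F, LinearMap.coe_mk, AddHom.coe_mk, Pi.zero_apply,
        show α + 1 + (k - (α + 1)) = k by omega] at h1
      rw [h1, coeff_zero]
    · rw [coeff_zero]
      refine coeff_eq_zero_of_natDegree_lt (lt_of_le_of_lt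
        (natDegree_coeff_mul_le (b := 0) (hLc v) (by simpa using hA) k) ?_)
      omega

theorem exists_coeff_mul_eq_zero_not_dvd {K : Type*} [Field K] {A : K[X][X]} {e : ℕ} (α β : ℕ)
    (hA : ∀ n, (A.coeff n).natDegree ≤ n * e) (c : K) :
    ∃ P : K[X][X], ¬ C (X - C c) ∣ P ∧ P.natDegree ≤ β ∧
      (∀ n, (P.coeff n).natDegree ≤ e * α * β + n * e) ∧
      ∀ k, α < k → k ≤ α + β → (P * A).coeff k = 0 := by
  obtain ⟨P, hP0, hP1, hP2, hP3⟩ := exists_coeff_mul_eq_zero α β hA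
  have hunit : ¬ IsUnit (C (X - C c) : K[X][X]) := by
    rw [isUnit_C]
    exact not_isUnit_X_sub_C c
  obtain ⟨R, hR, hRd⟩ :=
    (FiniteMultiplicity.of_not_isUnit hunit hP0).exists_eq_pow_mul_and_not_dvd
  set m := multiplicity (C (X - C c)) P
  have hc : (X - C c) ^ m ≠ 0 := pow_ne_zero _ (X_sub_C_ne_zero c)
  rw [← C_pow] at hR
  refine ⟨R, hRd, ?_, fun n => ?_, fun k hk hk' => ?_⟩
  · rwa [hR, natDegree_C_mul hc] at hP1
  · have := hP2 n
    rw [hR, coeff_C_mul] at this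
    rcases eq_or_ne (R.coeff n) 0 with h | h
    · simp [h]
    · rw [natDegree_mul hc h] at this
      omega
  · have := hP3 k hk hk'
    rw [hR, mul_assoc, coeff_C_mul] at this
    exact (mul_eq_zero.1 this).resolve_left hc

end

section
open Polynomial

theorem natDegree_eval_le {R : Type*} [CommRing R] {P : R[X][X]} {t : R[X]} {m b e l : ℕ}
    (hP : ∀ n, (P.coeff n).natDegree ≤ m + n * e) (hb : P.natDegree ≤ b) (ht : t.natDegree ≤ l) :
    (P.eval t).natDegree ≤ m + b * (e + l) := by
  rw [eval_eq_sum_range]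
  refine natDegree_sum_le_of_forall_le _ _ fun i hi => natDegree_mul_le.trans ?_
  have h1 : i ≤ b := (Nat.le_of_lt_succ (mem_range.1 hi)).trans hb
  have h2 := (natDegree_pow_le (p := t) (n := i)).trans (Nat.mul_le_mul_left i ht)
  have h3 := hP i
  have h4 := Nat.mul_le_mul_right (e + l) h1
  rw [mul_add] at h4
  omega

theorem mul_card_le_natDegree {K : Type*} [Field K] {F : K[X]} (hF : F ≠ 0) {T : Finset K} {r : ℕ}
    (h : ∀ x ∈ T, (X - C x) ^ r ∣ F) : r * #T ≤ F.natDegree := by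
  have h1 : ∏ x ∈ T, (X - C x) ^ r ∣ F :=
    prod_dvd_of_coprime
      (fun x _ y _ hxy => (pairwise_coprime_X_sub_C Function.injective_id hxy).pow) h
  have h2 := natDegree_le_of_dvd h1 hF
  rw [natDegree_prod_of_monic _ _ fun x _ => (monic_X_sub_C x).pow r] at h2
  simpa [mul_comm] using h2

/-- For `f = ∏ c ∈ S, (X - c)`, the polynomial `f(x + f(x) τ) / f(x)` in `τ` with coefficients
in `K[x]`. -/
noncomputable def taylorRatio {K : Type*} [Field K] [DecidableEq K] (S : Finset K) : K[X][X] :=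
  ∏ c ∈ S, (1 + X * C (∏ b ∈ S.erase c, (X - C b)))

theorem natDegree_coeff_taylorRatio_le {K : Type*} [Field K] [DecidableEq K] (S : Finset K)
    (k : ℕ) : ((taylorRatio S).coeff k).natDegree ≤ k * (#S - 1) := by
  refine natDegree_coeff_prod_le (fun c hc k => ?_) k
  rw [coeff_add, coeff_one, mul_comm, coeff_C_mul, coeff_X]
  rcases eq_or_ne k 1 with rfl | hk
  · simp [natDegree_finsetProd_X_sub_C_eq_card, card_erase_of_mem hc]
  · rw [if_neg hk.symm, mul_zero, add_zero]
    split_ifs <;> simp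

theorem taylorRatio_map_evalRingHom {K : Type*} [Field K] [DecidableEq K] {S : Finset K} {c : K}
    (hc : c ∈ S) :
    (taylorRatio S).map (evalRingHom c) = 1 + X * C (∏ b ∈ S.erase c, (c - b)) := by
  rw [taylorRatio, Polynomial.map_prod, ← mul_prod_erase S _ hc]
  conv_rhs => rw [← mul_one (1 + X * C _)]
  congr 1
  · simp only [Polynomial.map_add, Polynomial.map_one, Polynomial.map_mul, map_X, map_C,
      coe_evalRingHom, eval_prod, eval_sub, eval_X, eval_C]
  · refine prod_eq_one fun b hb => ?_
    simp only [Polynomial.map_add, Polynomial.map_one, Polynomial.map_mul, map_X, map_C,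
      coe_evalRingHom, eval_prod, eval_sub, eval_X, eval_C]
    rw [prod_eq_zero (mem_erase.2 ⟨(ne_of_mem_erase hb).symm, hc⟩) (sub_self c), C_0, mul_zero,
      add_zero]

theorem prod_X_sub_C_mul_prod_compl {p : ℕ} [Fact p.Prime] (S : Finset (ZMod p)) :
    (∏ c ∈ S, (X - C c)) * ∏ c ∈ Sᶜ, (X - C c) = X ^ p - X := by
  have hp := (Fact.out (p := p.Prime))
  have hr := FiniteField.roots_X_pow_card_sub_X (ZMod p)
  rw [ZMod.card] at hr
  have hdeg := FiniteField.X_pow_card_sub_X_natDegree_eq (ZMod p) hp.one_lt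
  have hmon : (X ^ p - X : (ZMod p)[X]).Monic :=
    monic_X_pow_sub (by rw [degree_X]; exact_mod_cast hp.one_lt)
  have := prod_multiset_X_sub_C_of_monic_of_roots_card_eq hmon
    (by rw [hr, hdeg, card_val, card_univ, ZMod.card])
  rw [hr] at this
  rw [prod_mul_prod_compl, ← this]
  rfl

theorem taylorRatio_eval {p : ℕ} [Fact p.Prime] (S : Finset (ZMod p)) :
    (taylorRatio S).eval (∏ c ∈ Sᶜ, (X - C c)) = (∏ c ∈ S, (X - C c)) ^ (p - 1) := by
  have hp := (Fact.out (p := p.Prime))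
  refine mul_left_cancel₀ (prod_ne_zero_iff.2 fun x (_ : x ∈ S) => X_sub_C_ne_zero x) ?_
  rw [mul_pow_sub_one hp.ne_zero, taylorRatio, eval_prod, ← prod_mul_distrib, ← prod_pow]
  refine prod_congr rfl fun c hc => ?_
  rw [sub_pow_char, ← C_pow, ZMod.pow_card]
  simp only [eval_add, eval_one, eval_mul, eval_X, eval_C]
  linear_combination (∏ c ∈ Sᶜ, (X - C c)) * mul_prod_erase S (fun b => X - C b) hc +
    prod_X_sub_C_mul_prod_compl S

theorem eval_eval_ne_zero {p : ℕ} [Fact p.Prime] {S : Finset (ZMod p)} {c : ZMod p} (hc : c ∈ S)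
    {α β n : ℕ} {P Q : (ZMod p)[X][X]} (hPd : ¬ C (X - C c) ∣ P) (hP : P.natDegree ≤ β)
    (hQ : Q.natDegree ≤ α) (hα : 0 < α) (hαn : α ≤ n) (hn : n + β < p)
    (h : X ^ (α + β + 1) ∣ P * taylorRatio S ^ (n + 1) - Q) :
    (Q.eval (∏ c ∈ Sᶜ, (X - C c))).eval c ≠ 0 := by
  intro h0
  have hp := (Fact.out (p := p.Prime))
  have hev (G : (ZMod p)[X][X]) (t : (ZMod p)[X]) :
      (G.map (evalRingHom c)).eval (t.eval c) = (G.eval t).eval c := by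
    rw [eval_map]
    exact eval₂_at_apply (evalRingHom c) t
  have hu : ∏ b ∈ S.erase c, (c - b) ≠ 0 :=
    prod_ne_zero_iff.2 fun b hb => sub_ne_zero.2 (ne_of_mem_erase hb).symm
  have hmap := taylorRatio_map_evalRingHom hc
  have ht := hev (taylorRatio S) (∏ c ∈ Sᶜ, (X - C c))
  rw [taylorRatio_eval, hmap] at ht
  set t : (ZMod p)[X] := ∏ c ∈ Sᶜ, (X - C c)
  have hfc : (∏ b ∈ S, (X - C b)).eval c = 0 := by
    rw [eval_prod, prod_eq_zero hc (by rw [eval_sub, eval_X, eval_C, sub_self])]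
  rw [eval_pow, hfc, zero_pow (by have := hp.two_le; omega)] at ht
  simp only [eval_add, eval_one, eval_mul, eval_X, eval_C] at ht
  refine hPd ((C_dvd_iff_dvd_coeff _ _).2 fun i => dvd_iff_isRoot.2 ?_)
  have hP0 : P.map (evalRingHom c) = 0 := by
    refine eq_zero_of_X_pow_dvd (Q := Q.map (evalRingHom c)) hu (natDegree_map_le.trans hP)
      (natDegree_map_le.trans hQ) hα hαn hn ?_ ?_
    · rw [← h0, ← hev]
      congr 1
      field_simp
      linear_combination -ht
    · simpa [hmap] using Polynomial.map_dvd (evalRingHom c) h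
  simpa using congrArg (coeff · i) hP0

theorem mul_card_filter_pow_eq_le {p : ℕ} [Fact p.Prime] (hp2 : p ≠ 2) {S : Finset (ZMod p)}
    {α β : ℕ} (hS : S.Nonempty) (hα : α ≤ p / 2) (hSα : #S ≤ 2 * (α - β))
    {ε : ZMod p} (hε : ε ≠ 0) :
    (α + β + 1) * #{x : ZMod p | (∏ c ∈ S, (x - c)) ^ (p / 2) = ε} ≤
      (#S - 1) * α * β + (p - 1) * α := by
  obtain ⟨c, hc⟩ := hS
  have hp := (Fact.out (p := p.Prime))
  have hodd := hp.eq_two_or_odd'.resolve_left hp2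
  obtain ⟨n, hn⟩ := hodd
  have hpn : p / 2 = n := by omega
  have hd : 0 < #S := card_pos.2 ⟨c, hc⟩
  rw [hpn] at hα ⊢
  set f : (ZMod p)[X] := ∏ c ∈ S, (X - C c) with hf
  set t : (ZMod p)[X] := ∏ c ∈ Sᶜ, (X - C c) with ht
  have hfdeg : f.natDegree = #S := natDegree_finsetProd_X_sub_C_eq_card S id
  have htdeg : t.natDegree = p - #S := by
    rw [ht, natDegree_finsetProd_X_sub_C_eq_card, card_compl, ZMod.card]
  have hSp : #S ≤ p := by simpa [ZMod.card] using card_le_univ S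
  have hEt : (taylorRatio S).eval t = f ^ (p - 1) := taylorRatio_eval S
  have hAc (k : ℕ) : ((taylorRatio S ^ (n + 1)).coeff k).natDegree ≤ k * (#S - 1) := by
    rw [← card_range (n + 1), ← prod_const]
    exact natDegree_coeff_prod_le (fun _ _ => natDegree_coeff_taylorRatio_le S) k
  obtain ⟨P, hPd, hPβ, hPc, hP0⟩ := exists_coeff_mul_eq_zero_not_dvd α β hAc c
  set Q : (ZMod p)[X][X] := ∑ k ∈ range (α + 1),
    monomial k ((P * taylorRatio S ^ (n + 1)).coeff k) with hQ
  have hQα : Q.natDegree ≤ α :=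
    natDegree_sum_le_of_forall_le _ _ fun k hk =>
      (natDegree_monomial_le _).trans (Nat.le_of_lt_succ (mem_range.1 hk))
  have hQcoeff (k : ℕ) : Q.coeff k = if k ≤ α then (P * taylorRatio S ^ (n + 1)).coeff k else 0 := by
    simp [hQ, finsetSum_coeff, coeff_monomial]
  have hQc (k : ℕ) : (Q.coeff k).natDegree ≤ (#S - 1) * α * β + k * (#S - 1) := by
    rw [hQcoeff]
    split_ifs
    · simpa using natDegree_coeff_mul_le (b := 0) hPc (by simpa using hAc) k
    · simp
  have hdvd : X ^ (α + β + 1) ∣ P * taylorRatio S ^ (n + 1) - Q := by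
    refine X_pow_dvd_iff.2 fun k hk => ?_
    rw [coeff_sub, hQcoeff]
    split_ifs with h
    · exact sub_self _
    · rw [hP0 k (by omega) (by omega), sub_zero]
  set F : (ZMod p)[X] := C ε * f ^ n * P.eval t - Q.eval t with hF
  have hF0 : F.eval c ≠ 0 := by
    have hfc : f.eval c = 0 := by rw [hf, eval_prod, prod_eq_zero hc (by simp)]
    have := eval_eval_ne_zero hc hPd hPβ hQα (by omega) hα (by omega) hdvd
    rw [hF, eval_sub, eval_mul, eval_mul, eval_pow, hfc, zero_pow (by have := hp.two_le; omega)]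
    simpa using this
  have hFdeg : F.natDegree ≤ (#S - 1) * α * β + (p - 1) * α := by
    have h1 := natDegree_eval_le hPc hPβ htdeg.le
    have h2 := natDegree_eval_le hQc hQα htdeg.le
    have h3 : (C ε * f ^ n).natDegree ≤ n * #S :=
      (natDegree_C_mul_le _ _).trans (natDegree_pow_le.trans (by rw [hfdeg]))
    rw [show #S - 1 + (p - #S) = 2 * n by omega] at h1 h2
    rw [show p - 1 = 2 * n by omega]
    refine (natDegree_sub_le_of_le (natDegree_mul_le_of_le h3 h1) h2).trans (max_le ?_ ?_)
    · have h4 := Nat.mul_le_mul_left n hSα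
      have h5 : n * (2 * (α - β)) + β * (2 * n) = 2 * n * α := by
        rw [mul_comm β, mul_left_comm, ← mul_assoc, ← mul_add]
        congr 1
        omega
      omega
    · rw [mul_comm α]
  refine (mul_card_le_natDegree (fun h => hF0 (by rw [h, eval_zero])) fun x hx => ?_).trans hFdeg
  rw [mem_filter_univ] at hx
  have hxt : X - C x ∣ t := by
    refine dvd_prod_of_mem _ (mem_compl.2 fun hxS => hε ?_)
    rw [← hx, prod_eq_zero hxS (sub_self x), zero_pow (by have := hp.two_le; omega)]
  have hxg : (X - C x) ^ p ∣ (f ^ n) ^ p - C ε := by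
    rw [← ZMod.pow_card ε, C_pow, ← sub_pow_char]
    refine pow_dvd_pow_of_dvd (dvd_iff_isRoot.2 ?_) p
    simp [hf, eval_prod, hx]
  have h1 : (X - C x) ^ (α + β + 1) ∣ P.eval t * (f ^ n) ^ (p + 1) - Q.eval t := by
    obtain ⟨H, hH⟩ := hdvd
    have := congrArg (eval t) hH
    simp only [eval_sub, eval_mul, eval_pow, eval_X, hEt] at this
    rw [← pow_mul, show n * (p + 1) = (p - 1) * (n + 1) by
      rw [hn, Nat.add_sub_cancel]; ring, pow_mul, this]
    exact (pow_dvd_pow_of_dvd hxt _).mul_right _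
  have h2 : (X - C x) ^ (α + β + 1) ∣ P.eval t * f ^ n * ((f ^ n) ^ p - C ε) :=
    ((pow_dvd_pow _ (by omega)).trans hxg).mul_left _
  convert h1.sub h2 using 1
  rw [hF]
  ring

end

theorem stepanov_parameter_inequality {s d γ α : ℝ} (hd : 1 ≤ d) (hds : d ≤ s) (hγ : 2 * γ ≤ d - 1)
    (hα : s / 2 ≤ α) (hα' : α ≤ s / 2 + 1) :
    2 * ((d - 1) * α * (α - γ - 1) + (s ^ 2 - 1) * α) ≤
      (2 * α - γ) * (s ^ 2 - d + d * s) := by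
  obtain ⟨e, rfl⟩ : ∃ e, α = s / 2 + e := ⟨α - s / 2, by ring⟩
  have he0 : 0 ≤ e := by linarith
  have he1 : e ≤ 1 := by linarith
  have h1 : 0 ≤ (s ^ 2 - d + d * s) / 2 - (s / 2 + e) * (d - 1) := by
    nlinarith [mul_nonneg (sub_nonneg.2 hd) (sub_nonneg.2 he1),
      mul_nonneg (sub_nonneg.2 hd) (sub_nonneg.2 hds)]
  have h2 := mul_nonneg h1 (show 0 ≤ (d - 1) / 2 - γ by linarith)
  have h3 : (d - 1) * (e - (d - 1) / 2) ≤ s := by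
    nlinarith [mul_nonneg (sub_nonneg.2 hd) (sub_nonneg.2 he1), sq_nonneg (d - 2)]
  have h4 := mul_le_mul_of_nonneg_left h3 he0
  have h5 : s * (d - 1) ≤ s ^ 2 := by nlinarith
  nlinarith

theorem abs_sum_quadraticChar_prod_le {p : ℕ} [Fact p.Prime] (hp2 : p ≠ 2) {S : Finset (ZMod p)}
    (hS : S.Nonempty) :
    |((∑ x : ZMod p, quadraticChar (ZMod p) (∏ c ∈ S, (x - c)) : ℤ) : ℝ)| ≤ #S * √p := by
  have hp := (Fact.out (p := p.Prime))
  have hp3 : 3 ≤ p := by have := hp.two_le; omega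
  have hs2 : √(p : ℝ) ^ 2 = p := Real.sq_sqrt p.cast_nonneg
  have hs0 : 0 ≤ √(p : ℝ) := Real.sqrt_nonneg _
  set s := √(p : ℝ) with hs
  have hd : 1 ≤ #S := card_pos.2 hS
  set f : ZMod p → ℤ := fun x => quadraticChar (ZMod p) (∏ c ∈ S, (x - c)) with hf
  have hf01 (x : ZMod p) : f x = (if f x = 1 then 1 else 0) - if f x = -1 then 1 else 0 := by
    obtain h | h | h : f x = 0 ∨ f x = 1 ∨ f x = -1 := quadraticChar_isQuadratic (ZMod p) _ <;>
      simp [h]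
  have hf02 (x : ZMod p) : (1 : ℤ) = ((if f x = 1 then 1 else 0) + if f x = -1 then 1 else 0) +
      if x ∈ S then 1 else 0 := by
    by_cases hx : x ∈ S
    · have : f x = 0 := by rw [hf]; simp [prod_eq_zero hx (sub_self x)]
      simp [this, hx]
    · have h0 : ∏ c ∈ S, (x - c) ≠ 0 :=
        prod_ne_zero_iff.2 fun c hc => sub_ne_zero.2 fun h => hx (h ▸ hc)
      obtain h | h : f x = 1 ∨ f x = -1 := quadraticChar_dichotomy h0 <;> simp [h, hx]
  have hsum1 : ∑ x, f x = (#{x | f x = 1} : ℤ) - #{x | f x = -1} := by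
    rw [sum_congr rfl fun x _ => hf01 x, sum_sub_distrib]
    simp
  have hsum2 : (p : ℤ) = #{x | f x = 1} + #{x | f x = -1} + #S := by
    have := sum_congr (rfl : (univ : Finset (ZMod p)) = univ) fun x _ => hf02 x
    rw [sum_add_distrib, sum_add_distrib] at this
    simpa [ZMod.card] using this
  rw [hsum1]
  have hsum2' : (p : ℝ) = #{x | f x = 1} + #{x | f x = -1} + #S := by exact_mod_cast hsum2
  push_cast
  rcases le_total s #S with hsd | hsd
  · have h1 : (0 : ℝ) ≤ #{x | f x = 1} := Nat.cast_nonneg _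
    have h2 : (0 : ℝ) ≤ #{x | f x = -1} := Nat.cast_nonneg _
    have h3 : (1 : ℝ) ≤ #S := by exact_mod_cast hd
    rw [abs_le]
    constructor <;> nlinarith
  have hs3 : (3 : ℝ) ≤ s ^ 2 := by rw [hs2]; exact_mod_cast hp3
  set α := ⌈s / 2⌉₊ with hα
  have hα1 : s / 2 ≤ α := Nat.le_ceil _
  have hα2 : (α : ℝ) < s / 2 + 1 := Nat.ceil_lt_add_one (by positivity)
  have hαp : α ≤ p / 2 := by
    have : (2 * α : ℝ) < p + 1 := by nlinarith
    have : 2 * α < p + 1 := by exact_mod_cast this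
    omega
  have hdα : (#S + 1) / 2 ≤ α := by
    have : (#S : ℝ) ≤ 2 * α := by linarith
    have : #S ≤ 2 * α := by exact_mod_cast this
    omega
  obtain ⟨γ, hγ⟩ : ∃ γ, (#S + 1) / 2 = γ + 1 := ⟨(#S + 1) / 2 - 1, by omega⟩
  obtain ⟨β, hβ⟩ : ∃ β, α = β + γ + 1 := ⟨α - (γ + 1), by omega⟩
  have hpar := stepanov_parameter_inequality (s := s) (d := #S) (γ := γ) (α := α)
    (by exact_mod_cast hd) hsd
    (by
      have : 2 * γ + 1 ≤ #S := by omega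
      have : (2 * γ + 1 : ℝ) ≤ #S := by exact_mod_cast this
      linarith) hα1 hα2.le
  have hcard {ε : ℤ} (hε : ε = 1 ∨ ε = -1) :
      (2 * #{x | f x = ε} : ℝ) ≤ p - #S + #S * s := by
    have hε0 : (ε : ZMod p) ≠ 0 := by rcases hε with rfl | rfl <;> simp
    have h1 := mul_card_filter_pow_eq_le hp2 (α := α) (β := β) hS hαp (by omega) hε0
    have h2 : #{x | f x = ε} ≤ #{x : ZMod p | (∏ c ∈ S, (x - c)) ^ (p / 2) = (ε : ZMod p)} := by
      refine card_le_card (monotone_filter_right _ fun x _ hx => ?_)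
      rw [← hx, hf, quadraticChar_eq_pow_of_char_ne_two' (by rwa [ZMod.ringChar_zmod_n]),
        ZMod.card]
    have h3 := (Nat.mul_le_mul_left (α + β + 1) h2).trans h1
    have h4 : ((α + β + 1 : ℕ) * #{x | f x = ε} : ℝ) ≤
        (#S - 1 : ℕ) * α * β + (p - 1 : ℕ) * α := by exact_mod_cast h3
    rw [Nat.cast_sub hd, Nat.cast_sub hp.one_le] at h4
    have hβ' : (β : ℝ) = α - γ - 1 := by rw [hβ]; push_cast; ring
    have hr : ((α + β + 1 : ℕ) : ℝ) = 2 * α - γ := by push_cast; rw [hβ']; ring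
    have hr0 : (0 : ℝ) < 2 * α - γ := by rw [← hr]; positivity
    rw [hr, hβ'] at h4
    rw [hs2] at hpar
    push_cast at h4
    refine le_of_mul_le_mul_left ?_ hr0
    linarith
  have h1 := hcard (Or.inl rfl)
  have h2 := hcard (Or.inr rfl)
  rw [abs_le]
  constructor <;> linarith

theorem abs_prod_sub_prod_le_sum {ι : Type*} {s : Finset ι} {a b : ι → ℝ}
    (ha : ∀ i ∈ s, |a i| ≤ 1) (hb : ∀ i ∈ s, |b i| ≤ 1) :
    |∏ i ∈ s, a i - ∏ i ∈ s, b i| ≤ ∑ i ∈ s, |a i - b i| := by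
  classical
  induction s using Finset.induction_on with
  | empty => simp
  | insert i s hi ih =>
    rw [prod_insert hi, prod_insert hi, sum_insert hi]
    have h1 := ih (fun j hj => ha j (mem_insert_of_mem hj)) fun j hj => hb j (mem_insert_of_mem hj)
    have h2 : |∏ j ∈ s, b j| ≤ 1 := by
      rw [abs_prod]
      exact prod_le_one (fun _ _ => abs_nonneg _) fun j hj => hb j (mem_insert_of_mem hj)
    calc |a i * ∏ j ∈ s, a j - b i * ∏ j ∈ s, b j|
        = |(a i - b i) * ∏ j ∈ s, b j + a i * (∏ j ∈ s, a j - ∏ j ∈ s, b j)| := by ring_nf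
      _ ≤ |a i - b i| * |∏ j ∈ s, b j| + |a i| * |∏ j ∈ s, a j - ∏ j ∈ s, b j| := by
        rw [← abs_mul, ← abs_mul]
        exact abs_add_le _ _
      _ ≤ |a i - b i| * 1 + 1 * ∑ j ∈ s, |a j - b j| := by
        gcongr
        exact ha i (mem_insert_self _ _)
      _ = _ := by ring

theorem two_mul_sum_powerset_card {ι : Type*} (s : Finset ι) :
    2 * ∑ t ∈ s.powerset, #t = #s * 2 ^ #s := by
  classical
  have h : ∑ t ∈ s.powerset, #t = ∑ t ∈ s.powerset, (#s - #t) := by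
    refine sum_nbij' (s \ ·) (s \ ·) ?_ ?_ ?_ ?_ ?_
    · simp
    · simp
    · intro t ht
      simpa using mem_powerset.1 ht
    · intro t ht
      simpa using mem_powerset.1 ht
    · intro t ht
      rw [card_sdiff_of_subset (mem_powerset.1 ht),
        Nat.sub_sub_self (card_le_card (mem_powerset.1 ht))]
  rw [two_mul]
  nth_rw 2 [h]
  rw [← sum_add_distrib, sum_congr rfl fun t ht =>
    Nat.add_sub_cancel' (card_le_card (mem_powerset.1 ht)), sum_const, card_powerset, smul_eq_mul,
    mul_comm]

theorem mem_QR_iff {p : ℕ} [NeZero p] {a : ZMod p} : a ∈ QR p ↔ IsSquare a := by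
  simp only [QR, mem_image, mem_range, isSquare_iff_exists_sq]
  constructor
  · rintro ⟨b, -, rfl⟩
    exact ⟨b, rfl⟩
  · rintro ⟨b, rfl⟩
    exact ⟨b.val, b.val_lt, by rw [ZMod.natCast_zmod_val]⟩

theorem univM_eq_univ (p : ℕ) [NeZero p] : univM p = univ :=
  eq_univ_of_forall fun a => mem_image.2 ⟨a.val, mem_range.2 a.val_lt, ZMod.natCast_zmod_val a⟩

theorem abs_sum_prod_quadraticChar_add_le {p : ℕ} [Fact p.Prime] (hp2 : p ≠ 2)
    {S : Finset (ZMod p)} (hS : S.Nonempty) :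
    |∑ x : ZMod p, ∏ c ∈ S, (quadraticChar (ZMod p) (x + c) : ℝ)| ≤ #S * √p := by
  have h := abs_sum_quadraticChar_prod_le hp2 (hS.image (- ·))
  rw [card_image_of_injective _ neg_injective] at h
  simpa [prod_image neg_injective.injOn] using h

theorem abs_sum_prod_half_sub_le {p : ℕ} [Fact p.Prime] (hp2 : p ≠ 2) (S : Finset (ZMod p))
    {σ : ZMod p → ℝ} (hσ : ∀ c, |σ c| = 1) :
    |∑ x : ZMod p, ∏ c ∈ S, (1 + σ c * quadraticChar (ZMod p) (x + c)) / 2 - p / 2 ^ #S| ≤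
      #S / 2 * √p := by
  have h1 : ∑ x : ZMod p, ∏ c ∈ S, (1 + σ c * quadraticChar (ZMod p) (x + c)) / 2 =
      (∑ T ∈ S.powerset, (∏ c ∈ T, σ c) *
        ∑ x : ZMod p, ∏ c ∈ T, (quadraticChar (ZMod p) (x + c) : ℝ)) / 2 ^ #S := by
    simp_rw [prod_div_distrib, prod_const, ← sum_div, prod_one_add, mul_sum, ← prod_mul_distrib]
    rw [sum_comm]
  have h2 (T : Finset (ZMod p)) (hT : T ≠ ∅) : |(∏ c ∈ T, σ c) *
      ∑ x : ZMod p, ∏ c ∈ T, (quadraticChar (ZMod p) (x + c) : ℝ)| ≤ #T * √p := by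
    rw [abs_mul, abs_prod, prod_congr rfl fun c _ => hσ c, prod_const_one, one_mul]
    exact abs_sum_prod_quadraticChar_add_le hp2 (nonempty_iff_ne_empty.2 hT)
  have h3 : (2 * ∑ T ∈ S.powerset, (#T : ℝ)) = #S * 2 ^ #S := by
    exact_mod_cast two_mul_sum_powerset_card S
  rw [h1, ← sub_div, abs_div, abs_of_pos (by positivity : (0 : ℝ) < 2 ^ #S),
    div_le_iff₀ (by positivity), ← add_sum_erase _ _ (empty_mem_powerset S)]
  simp only [prod_empty, sum_const, card_univ, ZMod.card, nsmul_eq_mul, mul_one, one_mul,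
    add_sub_cancel_left]
  calc _ ≤ ∑ T ∈ S.powerset.erase ∅, (#T * √p : ℝ) :=
        (abs_sum_le_sum_abs _ _).trans (sum_le_sum fun T hT => h2 T (ne_of_mem_erase hT))
    _ ≤ ∑ T ∈ S.powerset, (#T * √p : ℝ) :=
        sum_le_sum_of_subset_of_nonneg (erase_subset _ _) fun _ _ _ => by positivity
    _ = _ := by
      rw [← sum_mul]
      linear_combination √p / 2 * h3

theorem abs_card_RNsetZ_sub_sum_le {p : ℕ} [Fact p.Prime] {C₁ C₂ : Finset (ZMod p)}
    (hd : Disjoint C₁ C₂) :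
    |(#(RNsetZ p C₁ C₂) : ℝ) - ∑ x : ZMod p, ∏ c ∈ C₁ ∪ C₂,
      (1 + (if c ∈ C₁ then 1 else -1) * (quadraticChar (ZMod p) (x + c) : ℝ)) / 2| ≤
        #(C₁ ∪ C₂) / 2 := by
  classical
  set J : ZMod p → ZMod p → ℝ := fun c x => if c ∈ C₁ ↔ IsSquare (x + c) then 1 else 0 with hJ
  set b : ZMod p → ZMod p → ℝ := fun c x =>
    (1 + (if c ∈ C₁ then 1 else -1) * quadraticChar (ZMod p) (x + c)) / 2 with hb
  have hχ {a : ZMod p} (ha : a ≠ 0) :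
      (quadraticChar (ZMod p) a : ℝ) = if IsSquare a then 1 else -1 := by
    rw [quadraticChar_apply, quadraticCharFun, if_neg ha]
    push_cast
    rfl
  have hcard : (#(RNsetZ p C₁ C₂) : ℝ) = ∑ x : ZMod p, ∏ c ∈ C₁ ∪ C₂, J c x := by
    have hmem (x : ZMod p) :
        x ∈ RNsetZ p C₁ C₂ ↔ ∀ c ∈ C₁ ∪ C₂, (c ∈ C₁ ↔ IsSquare (x + c)) := by
      simp only [RNsetZ, univM_eq_univ, mem_filter_univ, mem_QR_iff, mem_union, or_imp, forall_and]
      refine and_congr (forall₂_congr fun c hc => by simp [hc]) (forall₂_congr fun c hc => ?_)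
      simp [disjoint_right.1 hd hc]
    have : (#(RNsetZ p C₁ C₂) : ℝ) = ∑ x, if x ∈ RNsetZ p C₁ C₂ then 1 else 0 := by simp
    rw [this]
    refine sum_congr rfl fun x _ => ?_
    split_ifs with h
    · exact (prod_eq_one fun c hc => if_pos ((hmem x).1 h c hc)).symm
    · rw [hmem] at h
      push Not at h
      obtain ⟨c, hc, h⟩ := h
      exact (prod_eq_zero hc (if_neg (by tauto))).symm
  have hdiff (c x : ZMod p) : |J c x - b c x| = if x = -c then 1 / 2 else 0 := by
    by_cases hx : x = -c
    · subst hx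
      by_cases hc : c ∈ C₁ <;> norm_num [hJ, hb, hc]
    · have h0 : x + c ≠ 0 := fun h => hx (eq_neg_of_add_eq_zero_left h)
      by_cases hc : c ∈ C₁ <;> by_cases hs : IsSquare (x + c) <;>
        simp only [hJ, hb, hχ h0] <;> norm_num [hc, hs, hx]
  have hJ1 (c x : ZMod p) : |J c x| ≤ 1 := by
    simp only [hJ]
    split_ifs <;> simp
  have hb1 (c x : ZMod p) : |b c x| ≤ 1 := by
    rcases quadraticChar_isQuadratic (ZMod p) (x + c) with h | h | h <;>
      by_cases hc : c ∈ C₁ <;> simp only [hb, h] <;> norm_num [hc, abs_le]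
  rw [hcard, ← sum_sub_distrib]
  calc _ ≤ ∑ x : ZMod p, ∑ c ∈ C₁ ∪ C₂, |J c x - b c x| :=
        (abs_sum_le_sum_abs _ _).trans (sum_le_sum fun x _ =>
          abs_prod_sub_prod_le_sum (fun c _ => hJ1 c x) fun c _ => hb1 c x)
    _ = _ := by
      rw [sum_comm]
      simp [hdiff, div_eq_mul_inv]

theorem abs_sub_le_of_le_two {n k : ℕ} (hn : n ≤ 2) (hk : k ≠ 0) :
    |(n : ℝ) - 2 * (2 ^ k)⁻¹| ≤ 0.5 * k * (√2 + 1) := by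
  have h1 : (1.4 : ℝ) ≤ √2 := Real.le_sqrt_of_sq_le (by norm_num)
  have hn0 : (0 : ℝ) ≤ n := n.cast_nonneg
  have hn2 : (n : ℝ) ≤ 2 := by exact_mod_cast hn
  obtain rfl | hk2 : k = 1 ∨ 2 ≤ k := by omega
  · rw [abs_le]
    norm_num
    constructor <;> linarith
  have hk2' : (2 : ℝ) ≤ k := by exact_mod_cast hk2
  have h2 : (0 : ℝ) < (2 ^ k)⁻¹ := by positivity
  have h3 : ((2 : ℝ) ^ k)⁻¹ ≤ 1 := inv_le_one_of_one_le₀ (one_le_pow₀ (by norm_num))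
  rw [abs_le]
  constructor <;> nlinarith

/-- Lemma 2.2: for `p` prime and disjoint `C₁, C₂ ⊆ Z_p`,
`||RN_p(C₁,C₂)| - p·2^(-(|C₁|+|C₂|))| ≤ 0.5·(|C₁|+|C₂|)·(√p + 1)`. -/
theorem stmt_7 (p : ℕ) (hp : p.Prime) (C₁ C₂ : Finset (ZMod p)) (hd : Disjoint C₁ C₂) :
    |((RNsetZ p C₁ C₂).card : ℝ) - (p : ℝ) * (2 : ℝ) ^ (-((C₁.card : ℤ) + C₂.card))| ≤
      0.5 * ((C₁.card : ℝ) + C₂.card) * (Real.sqrt p + 1) := by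
  have := Fact.mk hp
  have hk : (2 : ℝ) ^ (-((#C₁ : ℤ) + #C₂)) = (2 ^ #(C₁ ∪ C₂))⁻¹ := by
    rw [card_union_of_disjoint hd, zpow_neg, ← Nat.cast_add, zpow_natCast]
  have hk' : (#C₁ : ℝ) + #C₂ = #(C₁ ∪ C₂) := by
    rw [card_union_of_disjoint hd, Nat.cast_add]
  rw [hk, hk']
  rcases eq_or_ne p 2 with rfl | hp2
  · have hn : #(RNsetZ 2 C₁ C₂) ≤ 2 := card_le_univ _
    rcases eq_or_ne (#(C₁ ∪ C₂)) 0 with h0 | h0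
    · rw [card_eq_zero, union_eq_empty] at h0
      simp [RNsetZ, univM_eq_univ, h0.1, h0.2]
    · exact_mod_cast abs_sub_le_of_le_two hn h0
  · have h1 := abs_card_RNsetZ_sub_sum_le hd
    have h2 := abs_sum_prod_half_sub_le hp2 (C₁ ∪ C₂)
      (σ := fun c => if c ∈ C₁ then 1 else -1) fun c => by split_ifs <;> simp
    rw [← div_eq_mul_inv]
    refine (abs_sub_le _ _ _).trans ((add_le_add h1 h2).trans_eq ?_)
    ring
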